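/- Fix α ∈ (0, 1/2). For all σ > 0, μ > 0, and Ψ ≥ 0, the following inequality holds: exp(−(Ψ/σ − G(μ/σ))²/2)·(Ψ − G′(μ/σ)·μ) ≥ exp(−((Ψ + μ)/σ + G(μ/σ))²/2)·((G′(μ/σ) + 1)·μ + Ψ), where G′ denotes the derivative of G. -/

import Mathlib

open MeasureTheory ProbabilityTheory

/-- The standard normal cumulative distribution function. -/
noncomputable def Phi (x : ℝ) : ℝ := (gaussianReal 0 1 (Set.Iic x)).toReal

open Real Filter Topology

theorem hasDerivAt_Phi (x : ℝ) : HasDerivAt Phi (gaussianPDFReal 0 1 x) x := by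
  have hint : Integrable (gaussianPDFReal 0 1) := integrable_gaussianPDFReal 0 1
  have hcont : Continuous (gaussianPDFReal 0 1) := by
    unfold gaussianPDFReal
    fun_prop
  have hPhi : ∀ t, Phi t = ∫ u in Set.Iic t, gaussianPDFReal 0 1 u := fun t => by
    rw [Phi, gaussianReal_apply_eq_integral 0 one_ne_zero, ENNReal.toReal_ofReal]
    exact integral_nonneg fun u => gaussianPDFReal_nonneg 0 1 u
  have heq : Phi = fun t => (∫ u in (0 : ℝ)..t, gaussianPDFReal 0 1 u) + Phi 0 := by
    funext t
    rw [hPhi t, hPhi 0, ← intervalIntegral.integral_Iic_sub_Iic hint.integrableOn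
      hint.integrableOn]
    ring
  rw [heq]
  exact (intervalIntegral.integral_hasDerivAt_right (hcont.intervalIntegrable _ _)
    (hcont.stronglyMeasurableAtFilter _ _) hcont.continuousAt).add_const _

theorem strictMono_Phi : StrictMono Phi :=
  strictMono_of_hasDerivAt_pos hasDerivAt_Phi fun x => gaussianPDFReal_pos 0 1 x one_ne_zero

/-- A solution `G` of `Φ(G y + y) - Φ(-G y) = k` on `[0, ∞)` is `1`-Lipschitz. -/
theorem abs_sub_le_of_Phi_eq {G : ℝ → ℝ} {k : ℝ}
    (hG : ∀ y, 0 ≤ y → Phi (G y + y) - Phi (-(G y)) = k) {s t : ℝ} (hs : 0 ≤ s) (ht : 0 ≤ t) :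
    |G s - G t| ≤ |s - t| := by
  wlog hst : s ≤ t generalizing s t
  · rw [abs_sub_comm (G s), abs_sub_comm s]
    exact this ht hs (le_of_not_ge hst)
  have h1 := hG s hs
  have h2 := hG t ht
  have hanti : G t ≤ G s := by
    by_contra! h
    have h3 := strictMono_Phi (show G s + s < G t + t by linarith)
    have h4 := strictMono_Phi (neg_lt_neg h)
    linarith
  have hmono : G s + s ≤ G t + t := by
    by_contra! h
    have h3 := strictMono_Phi h
    have h4 := strictMono_Phi.monotone (neg_le_neg hanti)
    linarith
  rw [abs_of_nonneg (by linarith), abs_of_nonpos (by linarith)]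
  linarith

theorem hasDerivAt_of_Phi_eq {G : ℝ → ℝ} {k : ℝ}
    (hG : ∀ y, 0 ≤ y → Phi (G y + y) - Phi (-(G y)) = k) {y : ℝ} (hy : 0 < y) :
    HasDerivAt G (-gaussianPDFReal 0 1 (G y + y) /
      (gaussianPDFReal 0 1 (G y + y) + gaussianPDFReal 0 1 (-(G y)))) y := by
  have hpos : ∀ x, 0 < gaussianPDFReal 0 1 x := fun x => gaussianPDFReal_pos 0 1 x one_ne_zero
  have hcont : ContinuousAt G y := by
    refine tendsto_iff_dist_tendsto_zero.2 (squeeze_zero' (.of_forall fun _ => dist_nonneg) ?_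
      (tendsto_iff_dist_tendsto_zero.1 (tendsto_id (x := 𝓝 y))))
    filter_upwards [lt_mem_nhds hy] with t ht
    exact abs_sub_le_of_Phi_eq hG ht.le hy.le
  have hdslope : ∀ (f : ℝ → ℝ), ContinuousAt f y →
      Tendsto (fun t => dslope Phi (f y) (f t)) (𝓝 y) (𝓝 (gaussianPDFReal 0 1 (f y))) := by
    intro f hf
    have h := (continuousAt_dslope_same.2 (hasDerivAt_Phi (f y)).differentiableAt).tendsto
    rw [dslope_same, (hasDerivAt_Phi (f y)).deriv] at h
    exact h.comp hf
  have hA := hdslope (fun t => G t + t) (hcont.add continuousAt_id)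
  have hB := hdslope (fun t => -(G t)) hcont.neg
  have hne := (add_pos (hpos (G y + y)) (hpos (-(G y)))).ne'
  rw [hasDerivAt_iff_tendsto_slope]
  refine ((hA.neg.div (hA.add hB) hne).mono_left nhdsWithin_le_nhds).congr' ?_
  filter_upwards [nhdsWithin_le_nhds ((hA.add hB).eventually_ne hne),
    nhdsWithin_le_nhds (lt_mem_nhds hy), self_mem_nhdsWithin] with t hne_t ht hty
  have hty' : t - y ≠ 0 := sub_ne_zero.2 hty
  have h1 := sub_smul_dslope Phi (G y + y) (G t + t)
  have h2 := sub_smul_dslope Phi (-(G y)) (-(G t))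
  have h3 := hG t ht.le
  have h4 := hG y hy.le
  simp only [smul_eq_mul] at h1 h2
  simp only [Pi.div_apply]
  rw [slope_def_field, div_eq_div_iff hne_t hty']
  linear_combination h2 - h1 + h4 - h3

theorem exp_mul_le_exp_mul {a b c s y : ℝ} (hc : 0 ≤ c) (hs : 0 ≤ s) (hy : 0 ≤ y)
    (ha : a = exp (-c ^ 2 / 2)) (hb : b = exp (-(c + y) ^ 2 / 2)) :
    exp (-(s + y + c) ^ 2 / 2) * (s * (a + b) + a * y) ≤
      exp (-(s - c) ^ 2 / 2) * (s * (a + b) + b * y) := by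
  have ha0 : 0 < a := ha ▸ exp_pos _
  have hb0 : 0 < b := hb ▸ exp_pos _
  have hsc := mul_nonneg hs hc
  have hsy := mul_nonneg hs hy
  have hcy := mul_nonneg hc hy
  have h1 : exp (-(s + y + c) ^ 2 / 2) ≤ exp (-(s - c) ^ 2 / 2) :=
    exp_le_exp.2 (by nlinarith [sq_nonneg y])
  have h2 : exp (-(s + y + c) ^ 2 / 2) * a ≤ exp (-(s - c) ^ 2 / 2) * b := by
    rw [ha, hb, ← exp_add, ← exp_add]
    exact exp_le_exp.2 (by nlinarith)
  have h3 := mul_le_mul_of_nonneg_right h1 (mul_nonneg hs (add_pos ha0 hb0).le)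
  have h4 := mul_le_mul_of_nonneg_right h2 hy
  linarith

/-- For fixed `α ∈ (0, 1/2)`, with `G` the function assigning to each
`y ≥ 0` the unique `c > 0` with `Φ(c + y) − Φ(−c) = 1 − α`, for all `σ > 0`, `μ > 0`
and `Ψ ≥ 0`:
`exp(−(Ψ/σ − G(μ/σ))²/2)·(Ψ − G′(μ/σ)μ) ≥ exp(−((Ψ+μ)/σ + G(μ/σ))²/2)·((G′(μ/σ)+1)μ + Ψ)`. -/
theorem key_exponential_inequality
    (α : ℝ) (hα : 0 < α) (hα' : α < 1 / 2)
    (G : ℝ → ℝ)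
    (hG : ∀ y : ℝ, 0 ≤ y → 0 < G y ∧ Phi (G y + y) - Phi (-(G y)) = 1 - α)
    (σ μ Ψ : ℝ) (hσ : 0 < σ) (hμ : 0 < μ) (hΨ : 0 ≤ Ψ) :
    Real.exp (-(Ψ / σ - G (μ / σ)) ^ 2 / 2) * (Ψ - deriv G (μ / σ) * μ) ≥
      Real.exp (-((Ψ + μ) / σ + G (μ / σ)) ^ 2 / 2) * ((deriv G (μ / σ) + 1) * μ + Ψ) := by
  have hy : 0 < μ / σ := div_pos hμ hσ
  have hderiv := (hasDerivAt_of_Phi_eq (fun y h => (hG y h).2) hy).deriv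
  have hc := (hG _ hy.le).1
  have hpdf : ∀ x, gaussianPDFReal 0 1 x = (√(2 * π))⁻¹ * rexp (-x ^ 2 / 2) := fun x => by
    simp [gaussianPDFReal]
  have hμσ : μ = μ / σ * σ := (div_mul_cancel₀ μ hσ.ne').symm
  have hΨσ : Ψ = Ψ / σ * σ := (div_mul_cancel₀ Ψ hσ.ne').symm
  have hs : 0 ≤ Ψ / σ := div_nonneg hΨ hσ.le
  have key := exp_mul_le_exp_mul hc.le hs hy.le rfl rfl
  rw [hpdf, hpdf, neg_sq, ← mul_add, ← mul_neg,
    mul_div_mul_left _ _ (by positivity)] at hderiv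
  rw [add_div]
  generalize deriv G (μ / σ) = d at *
  generalize G (μ / σ) = c at *
  generalize μ / σ = y at *
  generalize Ψ / σ = s at *
  subst hμσ hΨσ
  have ha := exp_pos (-c ^ 2 / 2)
  have hb := exp_pos (-(c + y) ^ 2 / 2)
  generalize rexp (-c ^ 2 / 2) = a at *
  generalize rexp (-(c + y) ^ 2 / 2) = b at *
  have hab : 0 < a + b := add_pos ha hb
  have h1 : s * σ - d * (y * σ) = (s * (a + b) + b * y) * (σ / (a + b)) := by
    rw [hderiv]
    field_simp
    ring
  have h2 : (d + 1) * (y * σ) + s * σ = (s * (a + b) + a * y) * (σ / (a + b)) := by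
    rw [hderiv]
    field_simp
    ring
  rw [h1, h2, ← mul_assoc, ← mul_assoc]
  exact mul_le_mul_of_nonneg_right key (div_pos hσ hab).le
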